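/- For every N ≥ 1 and s ∈ (0,1), the sharp fractional Hardy constant of the half-space for p = 1 satisfies the two-sided bound C_{N,s}·(4/s) ≤ 𝔥_{s,1}(ℍ^N_+) ≤ C_{N,s}·𝔥_{s,1}(ℍ^1_+). -/

import Mathlib

open MeasureTheory Metric Set Filter
open scoped ENNReal NNReal

/-- The `p`-th power of the Gagliardo `(s,p)`-seminorm of `u` on `A ⊆ ℝ^N`,
valued in `[0,∞]`. -/
noncomputable def gagliardo (N : ℕ) (s p : ℝ) (A : Set (EuclideanSpace ℝ (Fin N)))
    (u : EuclideanSpace ℝ (Fin N) → ℝ) : ℝ≥0∞ :=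
  ∫⁻ x in A, ∫⁻ y in A, ENNReal.ofReal (|u x - u y| ^ p / dist x y ^ ((N : ℝ) + s * p))

/-- The sharp fractional Hardy constant `𝔥_{s,p}(Ω)`, an element of `[0,∞]`. -/
noncomputable def hardyConst (N : ℕ) (s p : ℝ) (Ω : Set (EuclideanSpace ℝ (Fin N))) : ℝ≥0∞ :=
  sInf { c : ℝ≥0∞ | ∃ u : EuclideanSpace ℝ (Fin N) → ℝ,
    ContDiff ℝ (⊤ : ℕ∞) u ∧ HasCompactSupport u ∧ tsupport u ⊆ Ω ∧
    (∫ x in Ω, |u x| ^ p / Metric.infDist x (frontier Ω) ^ (s * p)) = 1 ∧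
    c = gagliardo N s p Set.univ u }

/-- The half-space `ℍ^N₊ = (0,∞) × ℝ^{N-1}`. -/
noncomputable def halfSpace (N : ℕ) (hN : 0 < N) : Set (EuclideanSpace ℝ (Fin N)) :=
  {x | 0 < x ⟨0, hN⟩}

/-- The constant `C_{N,q}`. -/
noncomputable def Cconst (N : ℕ) (q : ℝ) : ℝ :=
  if N = 1 then 1 else
    ((N : ℝ) - 1) * (volume (Metric.ball (0 : EuclideanSpace ℝ (Fin (N - 1))) 1)).toReal *
      ∫ t in Set.Ioi (0 : ℝ), t ^ ((N : ℝ) - 2) / (1 + t ^ 2) ^ (((N : ℝ) + q) / 2)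


noncomputable def eMap (n : ℕ) (t : ℝ) (z : EuclideanSpace ℝ (Fin n)) :
    EuclideanSpace ℝ (Fin (n + 1)) :=
  WithLp.toLp 2 (Fin.cons t (WithLp.ofLp z) : Fin (n + 1) → ℝ)

lemma eMap_zero (n : ℕ) (t : ℝ) (z : EuclideanSpace ℝ (Fin n)) (h : 0 < n + 1) :
    (eMap n t z) ⟨0, h⟩ = t := rfl

lemma eMap_norm_sq (n : ℕ) (t : ℝ) (z : EuclideanSpace ℝ (Fin n)) :
    ‖eMap n t z‖ ^ 2 = t ^ 2 + ‖z‖ ^ 2 := by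
  rw [EuclideanSpace.norm_sq_eq, EuclideanSpace.norm_sq_eq, Fin.sum_univ_succ]
  simp [eMap]

lemma eMap_add (n : ℕ) (t t' : ℝ) (z z' : EuclideanSpace ℝ (Fin n)) :
    eMap n t z + eMap n t' z' = eMap n (t + t') (z + z') := by
  ext i
  refine Fin.cases ?_ (fun j => ?_) i <;> simp [eMap]

lemma eMap_sub (n : ℕ) (t t' : ℝ) (z z' : EuclideanSpace ℝ (Fin n)) :
    eMap n t z - eMap n t' z' = eMap n (t - t') (z - z') := by
  ext i
  refine Fin.cases ?_ (fun j => ?_) i <;> simp [eMap]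

lemma eMap_contDiff (n : ℕ) {m : WithTop ℕ∞} : ContDiff ℝ m
    (fun p : ℝ × EuclideanSpace ℝ (Fin n) => eMap n p.1 p.2) := by
  rw [contDiff_euclidean]
  intro i
  refine Fin.cases ?_ (fun j => ?_) i
  · simpa [eMap] using contDiff_fst
  · simp only [eMap, Fin.cons_succ]
    fun_prop

lemma eMap_continuous (n : ℕ) : Continuous
    (fun p : ℝ × EuclideanSpace ℝ (Fin n) => eMap n p.1 p.2) :=
  (eMap_contDiff n (m := 0)).continuous

@[fun_prop]
lemma eMap_continuous' {X : Type*} [TopologicalSpace X] (n : ℕ) (f : X → ℝ)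
    (g : X → EuclideanSpace ℝ (Fin n)) (hf : Continuous f) (hg : Continuous g) :
    Continuous (fun x => eMap n (f x) (g x)) :=
  (eMap_continuous n).comp (hf.prodMk hg)

@[fun_prop]
lemma eMap_measurable' {X : Type*} [MeasurableSpace X] (n : ℕ) (f : X → ℝ)
    (g : X → EuclideanSpace ℝ (Fin n)) (hf : Measurable f) (hg : Measurable g) :
    Measurable (fun x => eMap n (f x) (g x)) :=
  (eMap_continuous n).measurable.comp (hf.prodMk hg)

lemma eMap_mp (n : ℕ) : MeasurePreserving
    (fun p : ℝ × EuclideanSpace ℝ (Fin n) => eMap n p.1 p.2)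
    (volume.prod volume) volume := by
  have h1 := (volume_preserving_piFinSuccAbove (fun _ : Fin (n + 1) => ℝ) 0).symm
  have h2 := PiLp.volume_preserving_toLp (Fin (n + 1))
  have h3 : MeasurePreserving (Prod.map id (@WithLp.ofLp 2 (Fin n → ℝ)))
      ((volume : Measure ℝ).prod volume) (volume.prod volume) :=
    (MeasurePreserving.id volume).prod (PiLp.volume_preserving_ofLp (Fin n))
  have := h2.comp (h1.comp h3)
  have he : (fun p : ℝ × EuclideanSpace ℝ (Fin n) => eMap n p.1 p.2) = WithLp.toLp 2 ∘
      ⇑(MeasurableEquiv.piFinSuccAbove (fun _ : Fin (n + 1) => ℝ) 0).symm ∘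
      Prod.map id (@WithLp.ofLp 2 (Fin n → ℝ)) := by
    funext p
    ext i
    refine Fin.cases ?_ (fun j => ?_) i <;> simp [eMap, MeasurableEquiv.piFinSuccAbove]
  rw [he]
  exact this

lemma lintegral_eMap (n : ℕ) (f : EuclideanSpace ℝ (Fin (n + 1)) → ℝ≥0∞) (hf : Measurable f) :
    ∫⁻ x, f x = ∫⁻ t, ∫⁻ z, f (eMap n t z) := by
  rw [← (eMap_mp n).lintegral_comp hf, lintegral_prod _ (by fun_prop)]

lemma lintegral_zero_dim (f : EuclideanSpace ℝ (Fin 0) → ℝ≥0∞) : ∫⁻ z, f z = f 0 := by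
  rw [volume_euclideanSpace_eq_dirac, lintegral_dirac]

lemma lintegral_smul' {n : ℕ} (a : ℝ) (ha : 0 < a) (f : EuclideanSpace ℝ (Fin n) → ℝ≥0∞)
    (hf : Measurable f) :
    ∫⁻ z, f z = ENNReal.ofReal (a ^ n) * ∫⁻ z, f (a • z) := by
  have h := lintegral_map (μ := volume) hf (measurable_const_smul a : Measurable (fun z : EuclideanSpace ℝ (Fin n) => a • z))
  rw [Measure.map_addHaar_smul volume ha.ne', lintegral_smul_measure] at h
  rw [← h, smul_eq_mul, ← mul_assoc, ← ENNReal.ofReal_mul (by positivity)]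
  simp [abs_of_pos ha, ha.ne']

/-- the kernel -/
noncomputable def kerK (n : ℕ) (s : ℝ) (h : EuclideanSpace ℝ (Fin (n + 1))) : ℝ≥0∞ :=
  ENNReal.ofReal (1 / ‖h‖ ^ (((n : ℝ) + 1) + s))

@[fun_prop]
lemma kerK_measurable (n : ℕ) (s : ℝ) : Measurable (kerK n s) := by
  unfold kerK; fun_prop

lemma kerK_neg (n : ℕ) (s : ℝ) (h) : kerK n s (-h) = kerK n s h := by
  simp [kerK]

noncomputable def cPrime (n : ℕ) (s : ℝ) : ℝ≥0∞ :=
  ∫⁻ z : EuclideanSpace ℝ (Fin n), ENNReal.ofReal (1 / (1 + ‖z‖ ^ 2) ^ ((((n : ℝ) + 1) + s) / 2))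

lemma kerK_eMap (n : ℕ) (s : ℝ) (t : ℝ) (z : EuclideanSpace ℝ (Fin n)) :
    kerK n s (eMap n t z) = ENNReal.ofReal (1 / (t ^ 2 + ‖z‖ ^ 2) ^ ((((n : ℝ) + 1) + s) / 2)) := by
  rw [kerK, ← eMap_norm_sq, ← Real.rpow_natCast, ← Real.rpow_mul (norm_nonneg _)]
  congr 3
  push_cast; ring

lemma lintegral_kerK (n : ℕ) (s : ℝ) (t : ℝ) (ht : t ≠ 0) :
    ∫⁻ z, kerK n s (eMap n t z) = cPrime n s * ENNReal.ofReal (|t| ^ (-1 - s)) := by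
  have ha : 0 < |t| := abs_pos.mpr ht
  rw [lintegral_smul' |t| ha _ (by fun_prop), cPrime, ← lintegral_mul_const _ (by fun_prop),
    ← lintegral_const_mul _ (by fun_prop)]
  congr 1; ext z
  rw [kerK_eMap, ← ENNReal.ofReal_mul (by positivity), ← ENNReal.ofReal_mul (by positivity)]
  congr 1
  have e1 : t ^ 2 + ‖|t| • z‖ ^ 2 = |t| ^ 2 * (1 + ‖z‖ ^ 2) := by
    rw [norm_smul, Real.norm_eq_abs, abs_abs, mul_pow, sq_abs]; ring
  rw [e1, Real.mul_rpow (by positivity) (by positivity), ← Real.rpow_natCast |t| 2,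
    ← Real.rpow_mul ha.le, ← Real.rpow_natCast |t| n]
  have e2 : |t| ^ (n : ℝ) = |t| ^ (-1 - s) * |t| ^ (((2 : ℕ) : ℝ) * ((((n : ℝ) + 1) + s) / 2)) := by
    rw [← Real.rpow_add ha]; congr 1; push_cast; ring
  rw [e2]
  have : |t| ^ (((2 : ℕ) : ℝ) * ((((n : ℝ) + 1) + s) / 2)) ≠ 0 := (Real.rpow_pos_of_pos ha _).ne'
  have : (1 + ‖z‖ ^ 2) ^ ((((n : ℝ) + 1) + s) / 2) ≠ 0 := (Real.rpow_pos_of_pos (by positivity) _).ne'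
  field_simp

lemma cPrime_eq (n : ℕ) (s : ℝ) (hs : 0 < s) : cPrime n s = ENNReal.ofReal (Cconst (n + 1) s) := by
  rcases Nat.eq_zero_or_pos n with rfl | hn
  · rw [cPrime, lintegral_zero_dim]; simp [Cconst]
  · have : Nonempty (Fin n) := ⟨⟨0, hn⟩⟩
    have hi : Integrable (fun z : EuclideanSpace ℝ (Fin n) =>
        1 / (1 + ‖z‖ ^ 2) ^ ((((n : ℝ) + 1) + s) / 2)) := by
      have := integrable_rpow_neg_one_add_norm_sq (E := EuclideanSpace ℝ (Fin n)) (μ := volume)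
        (r := (n : ℝ) + 1 + s) (by simp; linarith)
      convert this using 2 with z
      rw [neg_div, Real.rpow_neg (by positivity), one_div]
    rw [cPrime, ← ofReal_integral_eq_lintegral_ofReal hi (by filter_upwards with z; positivity)]
    congr 1
    rw [integral_fun_norm_addHaar volume (fun r : ℝ => 1 / (1 + r ^ 2) ^ ((((n : ℝ) + 1) + s) / 2))]
    rw [Cconst, if_neg (by omega)]
    simp only [finrank_euclideanSpace, Fintype.card_fin, nsmul_eq_mul, smul_eq_mul,
      Nat.cast_add, Nat.cast_one, add_sub_cancel_right, Measure.real]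
    rw [← mul_assoc]
    congr 1
    apply setIntegral_congr_fun measurableSet_Ioi
    intro t ht
    simp only
    rw [← Real.rpow_natCast, Nat.cast_sub hn, mul_one_div]
    congr 2; push_cast; ring

lemma cPrime_ne_zero (n : ℕ) (s : ℝ) : cPrime n s ≠ 0 := by
  rw [cPrime, Ne, lintegral_eq_zero_iff (by fun_prop)]
  intro h
  have h2 : ∀ᵐ z : EuclideanSpace ℝ (Fin n), False := by
    filter_upwards [h] with z hz
    simp only [Pi.zero_apply, ENNReal.ofReal_eq_zero] at hz
    have : 0 < 1 / (1 + ‖z‖ ^ 2) ^ ((((n : ℝ) + 1) + s) / 2) := by positivity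
    linarith
  have h3 : (volume : Measure (EuclideanSpace ℝ (Fin n))) = 0 := by simpa using h2
  have h4 := measure_ball_pos (volume : Measure (EuclideanSpace ℝ (Fin n))) 0 one_pos
  rw [h3] at h4
  simp at h4

lemma infDist_half (n : ℕ) (t : ℝ) (ht : 0 < t) (z : EuclideanSpace ℝ (Fin n)) :
    infDist (eMap n t z) (frontier (halfSpace (n + 1) n.succ_pos)) = t := by
  have hfr : frontier (halfSpace (n + 1) n.succ_pos) =
      {x : EuclideanSpace ℝ (Fin (n + 1)) | x ⟨0, n.succ_pos⟩ = 0} := by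
    have hop : IsOpenMap (fun x : EuclideanSpace ℝ (Fin (n + 1)) => x ⟨0, n.succ_pos⟩) := by
      have : IsOpenMap (EuclideanSpace.proj ⟨0, n.succ_pos⟩ : EuclideanSpace ℝ (Fin (n + 1)) →L[ℝ] ℝ) := by
        apply ContinuousLinearMap.isOpenMap
        intro y
        exact ⟨eMap n y 0, rfl⟩
      exact this
    have hc : Continuous (fun x : EuclideanSpace ℝ (Fin (n + 1)) => x ⟨0, n.succ_pos⟩) := by
      fun_prop
    have := hop.preimage_frontier_eq_frontier_preimage hc (Ioi 0)
    rw [frontier_Ioi] at this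
    exact this.symm
  rw [hfr]
  apply le_antisymm
  · refine (infDist_le_dist_of_mem (y := eMap n 0 z) (by simp [eMap])).trans ?_
    rw [dist_eq_norm, eMap_sub]
    have := eMap_norm_sq n (t - 0) (z - z)
    simp only [sub_zero, sub_self, norm_zero] at this ⊢
    apply le_of_eq
    rw [← sq_eq_sq₀ (norm_nonneg _) ht.le, this]; ring
  · rw [le_infDist ⟨eMap n 0 z, by simp [eMap]⟩]
    intro y hy
    rw [dist_eq_norm]
    have h1 := EuclideanSpace.norm_sq_eq (eMap n t z - y)
    have h2 : ‖(eMap n t z - y) ⟨0, n.succ_pos⟩‖ ^ 2 ≤ ‖eMap n t z - y‖ ^ 2 := by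
      rw [h1]
      exact Finset.single_le_sum (f := fun i => ‖(eMap n t z - y) i‖ ^ 2) (fun i _ => by positivity) (Finset.mem_univ _)
    have h3 : (eMap n t z - y) ⟨0, n.succ_pos⟩ = t := by
      have hy' : y ⟨0, n.succ_pos⟩ = 0 := hy
      rw [PiLp.sub_apply, hy', eMap_zero, sub_zero]
    rw [h3, Real.norm_eq_abs, sq_abs] at h2
    exact (sq_le_sq₀ ht.le (norm_nonneg _)).mp h2

lemma norm_cond (n : ℕ) (s : ℝ) (u : EuclideanSpace ℝ (Fin (n + 1)) → ℝ) (hu : Continuous u) :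
    ((∫ x in halfSpace (n + 1) n.succ_pos, |u x| ^ (1 : ℝ) /
      infDist x (frontier (halfSpace (n + 1) n.succ_pos)) ^ (s * 1)) = 1) ↔
    ∫⁻ t in Ioi 0, ∫⁻ z, ENNReal.ofReal |u (eMap n t z)| * ENNReal.ofReal (t ^ (-s)) = 1 := by
  have hm : Measurable (fun x => |u x| ^ (1 : ℝ) /
      infDist x (frontier (halfSpace (n + 1) n.succ_pos)) ^ (s * 1)) := by
    have := hu.measurable
    fun_prop
  have hms : MeasurableSet (halfSpace (n + 1) n.succ_pos) := by
    apply measurableSet_lt <;> fun_prop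
  rw [integral_eq_lintegral_of_nonneg_ae (by
    filter_upwards with x
    have := infDist_nonneg (x := x) (s := (frontier (halfSpace (n + 1) n.succ_pos)))
    positivity) hm.aestronglyMeasurable, ENNReal.toReal_eq_one_iff,
    ← lintegral_indicator hms, lintegral_eMap _ _ (Measurable.indicator (by fun_prop) hms),
    ← lintegral_indicator measurableSet_Ioi]
  apply Eq.congr _ rfl
  congr 1; ext t
  by_cases ht : 0 < t
  · rw [indicator_of_mem (by exact ht)]
    congr 1; ext z
    rw [indicator_of_mem (by exact ht), infDist_half n t ht, ← ENNReal.ofReal_mul (abs_nonneg _)]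
    simp [Real.rpow_neg ht.le, div_eq_mul_inv]
  · rw [indicator_of_notMem (by exact ht)]
    simp only [halfSpace]
    simp [Set.indicator, eMap, ht]

lemma gag_eq (n : ℕ) (s : ℝ) (u : EuclideanSpace ℝ (Fin (n + 1)) → ℝ) :
    gagliardo (n + 1) s 1 univ u =
      ∫⁻ x, ∫⁻ y, ENNReal.ofReal |u x - u y| * kerK n s (x - y) := by
  simp only [gagliardo, Measure.restrict_univ, kerK]
  congr 1; ext x; congr 1; ext y
  rw [← ENNReal.ofReal_mul (abs_nonneg _), dist_eq_norm]
  congr 1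
  simp [div_eq_mul_inv]

lemma lint_Ioi (s : ℝ) (hs : 0 < s) (t : ℝ) (ht : 0 < t) :
    ∫⁻ τ in Ioi t, ENNReal.ofReal (|τ| ^ (-1 - s)) = ENNReal.ofReal (t ^ (-s) / s) := by
  have h1 : ∫⁻ τ in Ioi t, ENNReal.ofReal (|τ| ^ (-1 - s)) =
      ∫⁻ τ in Ioi t, ENNReal.ofReal (τ ^ (-1 - s)) := by
    apply setLIntegral_congr_fun measurableSet_Ioi
    intro τ hτ
    simp only
    rw [abs_of_pos (ht.trans hτ)]
  rw [h1, ← ofReal_integral_eq_lintegral_ofReal (integrableOn_Ioi_rpow_of_lt (by linarith) ht),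
    integral_Ioi_rpow_of_lt (by linarith) ht]
  · congr 1
    rw [show -1 - s + 1 = -s by ring]
    field_simp
  · filter_upwards [ae_restrict_mem measurableSet_Ioi] with τ hτ
    exact Real.rpow_nonneg (ht.trans hτ).le _

lemma lint_abs (s : ℝ) (hs : 0 < s) (t : ℝ) (ht : 0 < t) :
    ∫⁻ τ, {τ : ℝ | t ≤ |τ|}.indicator (fun τ => ENNReal.ofReal (|τ| ^ (-1 - s))) τ =
      ENNReal.ofReal (2 / s) * ENNReal.ofReal (t ^ (-s)) := by
  have hset : {τ : ℝ | t ≤ |τ|} = Iic (-t) ∪ Ici t := by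
    ext τ; simp only [mem_ofPred_eq, le_abs, mem_union, mem_Iic, mem_Ici]
    constructor
    · rintro (h | h)
      · right; exact h
      · left; linarith
    · rintro (h | h)
      · right; linarith
      · left; exact h
  have hI : ∫⁻ τ in Ici t, ENNReal.ofReal (|τ| ^ (-1 - s)) = ENNReal.ofReal (t ^ (-s) / s) := by
    rw [← lint_Ioi s hs t ht]
    exact setLIntegral_congr Ioi_ae_eq_Ici.symm
  have hI2 : ∫⁻ τ in Iic (-t), ENNReal.ofReal (|τ| ^ (-1 - s)) = ENNReal.ofReal (t ^ (-s) / s) := by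
    rw [← hI, ← lintegral_indicator measurableSet_Iic, ← lintegral_indicator measurableSet_Ici,
      ← lintegral_neg_eq_self]
    congr 1; ext τ
    simp [indicator]
  rw [lintegral_indicator (by rw [hset]; measurability), hset,
    lintegral_union measurableSet_Ici, hI, hI2, ← ENNReal.ofReal_mul (by positivity),
    ← ENNReal.ofReal_add (by positivity) (by positivity)]
  · congr 1; ring
  · rw [Set.disjoint_left]; intro τ h1 h2
    simp only [mem_Iic, mem_Ici] at h1 h2
    linarith

lemma trans_pos (n : ℕ) (u : EuclideanSpace ℝ (Fin (n + 1)) → ℝ) (hu : Measurable u)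
    (hfin : ∫⁻ x, ENNReal.ofReal |u x| ≠ ∞)
    (h0 : ∀ x, x ⟨0, n.succ_pos⟩ ≤ 0 → u x = 0)
    (h : EuclideanSpace ℝ (Fin (n + 1))) :
    2 * ∫⁻ x, {x | x ⟨0, n.succ_pos⟩ ≤ h ⟨0, n.succ_pos⟩}.indicator
        (fun x => ENNReal.ofReal |u x|) x ≤
      ∫⁻ x, ENNReal.ofReal |u x - u (x + h)| := by
  set p : EuclideanSpace ℝ (Fin (n + 1)) → ℝ := fun x => x ⟨0, n.succ_pos⟩ with hp
  have hpm : Measurable p := by fun_prop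
  have hpa : ∀ x, p (x + h) = p x + p h := fun x => rfl
  set S : Set (EuclideanSpace ℝ (Fin (n + 1))) := {x | p x ≤ p h} with hS
  set T : Set (EuclideanSpace ℝ (Fin (n + 1))) := {x | p x ≤ 0} with hT
  have hSm : MeasurableSet S := measurableSet_le hpm measurable_const
  have hTm : MeasurableSet T := measurableSet_le hpm measurable_const
  set U : EuclideanSpace ℝ (Fin (n + 1)) → ℝ≥0∞ := fun x => ENNReal.ofReal |u x| with hU
  have hUm : Measurable U := by fun_prop
  have e1 : ∫⁻ x in T, U (x + h) = ∫⁻ x in S, U x := by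
    rw [← lintegral_indicator hTm, ← lintegral_indicator hSm,
      ← lintegral_add_right_eq_self (S.indicator U) h]
    congr 1; ext x
    simp [indicator, hS, hT, hpa]
  have e2 : ∫⁻ x in Tᶜ, U (x + h) = ∫⁻ x in Sᶜ, U x := by
    rw [← lintegral_indicator hTm.compl, ← lintegral_indicator hSm.compl,
      ← lintegral_add_right_eq_self (Sᶜ.indicator U) h]
    congr 1; ext x
    simp [indicator, hS, hT, hpa]
  have e3 : (∫⁻ x in S, U x) + ∫⁻ x in Sᶜ, U x = ∫⁻ x, U x := lintegral_add_compl _ hSm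
  have e4 : (∫⁻ x in T, U x) + ∫⁻ x in Tᶜ, U x = ∫⁻ x, U x := lintegral_add_compl _ hTm
  have e5 : ∫⁻ x in T, U x = 0 := by
    rw [setLIntegral_congr_fun (g := fun _ => 0) hTm]
    · simp
    · intro x hx
      simp [hU, h0 x hx]
  have e6 : ∫⁻ x in Tᶜ, U x ≤ (∫⁻ x in Tᶜ, ENNReal.ofReal |u x - u (x + h)|) + ∫⁻ x in Tᶜ, U (x + h) := by
    rw [← lintegral_add_right _ (by fun_prop)]
    apply lintegral_mono
    intro x
    simp only [hU]
    rw [← ENNReal.ofReal_add (abs_nonneg _) (abs_nonneg _)]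
    apply ENNReal.ofReal_le_ofReal
    have := abs_add_le (u x - u (x + h)) (u (x + h))
    simpa using this
  have e7 : ∫⁻ x in T, ENNReal.ofReal |u x - u (x + h)| = ∫⁻ x in T, U (x + h) := by
    apply setLIntegral_congr_fun hTm
    intro x hx
    simp [hU, h0 x hx]
  rw [lintegral_indicator hSm, ← lintegral_add_compl (fun x => ENNReal.ofReal |u x - u (x + h)|) hTm, e7, e1, two_mul]
  refine add_le_add le_rfl ?_
  have hB : ∫⁻ x in Sᶜ, U x ≠ ∞ := ne_top_of_le_ne_top hfin (setLIntegral_le_lintegral _ _)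
  rw [e2] at e6
  rw [e5, zero_add] at e4
  rw [e4, ← e3] at e6
  exact (ENNReal.add_le_add_iff_right hB).mp e6

lemma trans_abs (n : ℕ) (u : EuclideanSpace ℝ (Fin (n + 1)) → ℝ) (hu : Measurable u)
    (hfin : ∫⁻ x, ENNReal.ofReal |u x| ≠ ∞)
    (h0 : ∀ x, x ⟨0, n.succ_pos⟩ ≤ 0 → u x = 0)
    (h : EuclideanSpace ℝ (Fin (n + 1))) :
    2 * ∫⁻ x, {x | x ⟨0, n.succ_pos⟩ ≤ |h ⟨0, n.succ_pos⟩|}.indicator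
        (fun x => ENNReal.ofReal |u x|) x ≤
      ∫⁻ x, ENNReal.ofReal |u x - u (x + h)| := by
  rcases le_total 0 (h ⟨0, n.succ_pos⟩) with h1 | h1
  · rw [abs_of_nonneg h1]
    exact trans_pos n u hu hfin h0 h
  · rw [abs_of_nonpos h1]
    refine (trans_pos n u hu hfin h0 (-h)).trans (le_of_eq ?_)
    rw [← lintegral_add_right_eq_self _ h]
    congr 1; ext x
    rw [add_neg_cancel_right, abs_sub_comm]

lemma gag_eq' (n : ℕ) (s : ℝ) (u : EuclideanSpace ℝ (Fin (n + 1)) → ℝ) (hu : Measurable u) :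
    gagliardo (n + 1) s 1 univ u =
      ∫⁻ h, kerK n s h * ∫⁻ x, ENNReal.ofReal |u x - u (x + h)| := by
  rw [gag_eq]
  have : ∀ x, ∫⁻ y, ENNReal.ofReal |u x - u y| * kerK n s (x - y) =
      ∫⁻ h, kerK n s h * ENNReal.ofReal |u x - u (x + h)| := by
    intro x
    rw [← lintegral_add_left_eq_self _ x]
    congr 1; ext h
    rw [show x - (x + h) = -h by abel, kerK_neg, mul_comm]
  simp_rw [this]
  rw [lintegral_lintegral_swap]
  · congr 1; ext h
    rw [lintegral_const_mul _ (by fun_prop)]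
  · apply Measurable.aemeasurable
    simp only [Function.uncurry_def]
    fun_prop

lemma lower_aux (n : ℕ) (s : ℝ) (hs : 0 < s) (u : EuclideanSpace ℝ (Fin (n + 1)) → ℝ)
    (hu : Measurable u)
    (hfin : ∫⁻ x, ENNReal.ofReal |u x| ≠ ∞)
    (h0 : ∀ x, x ⟨0, n.succ_pos⟩ ≤ 0 → u x = 0)
    (h1 : ∫⁻ t in Ioi 0, ∫⁻ z, ENNReal.ofReal |u (eMap n t z)| * ENNReal.ofReal (t ^ (-s)) = 1) :
    cPrime n s * ENNReal.ofReal (4 / s) ≤ gagliardo (n + 1) s 1 univ u := by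
  rw [gag_eq' n s u hu]
  have hSm : MeasurableSet {q : EuclideanSpace ℝ (Fin (n + 1)) × EuclideanSpace ℝ (Fin (n + 1)) |
      q.2 ⟨0, n.succ_pos⟩ ≤ |q.1 ⟨0, n.succ_pos⟩|} := by
    apply measurableSet_le <;> fun_prop
  have hmeas : Measurable (fun q : EuclideanSpace ℝ (Fin (n + 1)) × EuclideanSpace ℝ (Fin (n + 1)) =>
      {q : EuclideanSpace ℝ (Fin (n + 1)) × EuclideanSpace ℝ (Fin (n + 1)) |
      q.2 ⟨0, n.succ_pos⟩ ≤ |q.1 ⟨0, n.succ_pos⟩|}.indicator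
        (fun q => kerK n s q.1 * (2 * ENNReal.ofReal |u q.2|)) q) := by
    apply Measurable.indicator _ hSm
    fun_prop
  have key : ∫⁻ h, kerK n s h * (2 * ∫⁻ x, {x : EuclideanSpace ℝ (Fin (n + 1)) |
        x ⟨0, n.succ_pos⟩ ≤ |h ⟨0, n.succ_pos⟩|}.indicator (fun x => ENNReal.ofReal |u x|) x)
      = cPrime n s * ENNReal.ofReal (4 / s) := by
    have st : ∀ h : EuclideanSpace ℝ (Fin (n + 1)), kerK n s h * (2 * ∫⁻ x, {x : EuclideanSpace ℝ (Fin (n + 1)) |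
        x ⟨0, n.succ_pos⟩ ≤ |h ⟨0, n.succ_pos⟩|}.indicator (fun x => ENNReal.ofReal |u x|) x) =
        ∫⁻ x, {q : EuclideanSpace ℝ (Fin (n + 1)) × EuclideanSpace ℝ (Fin (n + 1)) |
      q.2 ⟨0, n.succ_pos⟩ ≤ |q.1 ⟨0, n.succ_pos⟩|}.indicator
        (fun q => kerK n s q.1 * (2 * ENNReal.ofReal |u q.2|)) (h, x) := by
      intro h
      have hm2 : Measurable (fun x => {x : EuclideanSpace ℝ (Fin (n + 1)) |
        x ⟨0, n.succ_pos⟩ ≤ |h ⟨0, n.succ_pos⟩|}.indicator (fun x => ENNReal.ofReal |u x|) x) := by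
        apply Measurable.indicator (by fun_prop)
        apply measurableSet_le <;> fun_prop
      rw [← lintegral_const_mul _ hm2, ← lintegral_const_mul _ (hm2.const_mul _)]
      congr 1; ext x
      simp only [indicator, mem_ofPred_eq]
      split_ifs <;> simp
    simp_rw [st]
    rw [lintegral_lintegral_swap hmeas.aemeasurable,
      lintegral_eMap _ _ (hmeas.lintegral_prod_left')]
    rw [← mul_one (cPrime n s * ENNReal.ofReal (4 / s)), ← h1,
      ← lintegral_const_mul _ (by fun_prop), ← lintegral_indicator measurableSet_Ioi]
    congr 1; ext t
    by_cases ht : 0 < t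
    · rw [indicator_of_mem (by exact ht), ← lintegral_const_mul _ (by fun_prop)]
      congr 1; ext z
      rw [lintegral_eMap n (fun h => {q : EuclideanSpace ℝ (Fin (n + 1)) × EuclideanSpace ℝ (Fin (n + 1)) |
      q.2 ⟨0, n.succ_pos⟩ ≤ |q.1 ⟨0, n.succ_pos⟩|}.indicator
        (fun q => kerK n s q.1 * (2 * ENNReal.ofReal |u q.2|)) (h, eMap n t z)) (hmeas.comp (by fun_prop : Measurable (fun h => (h, eMap n t z))))]
      have st2 : ∀ τ : ℝ, ∫⁻ ζ, {q : EuclideanSpace ℝ (Fin (n + 1)) × EuclideanSpace ℝ (Fin (n + 1)) |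
          q.2 ⟨0, n.succ_pos⟩ ≤ |q.1 ⟨0, n.succ_pos⟩|}.indicator
          (fun q => kerK n s q.1 * (2 * ENNReal.ofReal |u q.2|)) (eMap n τ ζ, eMap n t z) =
          (cPrime n s * (2 * ENNReal.ofReal |u (eMap n t z)|)) *
          {τ : ℝ | t ≤ |τ|}.indicator (fun τ => ENNReal.ofReal (|τ| ^ (-1 - s))) τ := by
        intro τ
        by_cases hc : t ≤ |τ|
        · have hm : ∀ ζ, (eMap n τ ζ, eMap n t z) ∈ {q : EuclideanSpace ℝ (Fin (n + 1)) × EuclideanSpace ℝ (Fin (n + 1)) |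
              q.2 ⟨0, n.succ_pos⟩ ≤ |q.1 ⟨0, n.succ_pos⟩|} := fun ζ => hc
          rw [lintegral_congr (fun ζ => indicator_of_mem (hm ζ) _)]
          rw [indicator_of_mem (show τ ∈ {τ : ℝ | t ≤ |τ|} from hc)]
          dsimp only
          rw [lintegral_mul_const _ (by fun_prop), lintegral_kerK n s τ (by
            rintro rfl; simp at hc; linarith)]
          ring
        · have hm : ∀ ζ, (eMap n τ ζ, eMap n t z) ∉ {q : EuclideanSpace ℝ (Fin (n + 1)) × EuclideanSpace ℝ (Fin (n + 1)) |
              q.2 ⟨0, n.succ_pos⟩ ≤ |q.1 ⟨0, n.succ_pos⟩|} := fun ζ => hc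
          rw [lintegral_congr (fun ζ => indicator_of_notMem (hm ζ) _)]
          rw [indicator_of_notMem (show τ ∉ {τ : ℝ | t ≤ |τ|} from hc)]
          simp
      simp_rw [st2]
      rw [lintegral_const_mul _ (by
        apply Measurable.indicator (by fun_prop)
        apply measurableSet_le <;> fun_prop), lint_abs s hs t ht]
      have : ENNReal.ofReal (4 / s) = 2 * ENNReal.ofReal (2 / s) := by
        rw [show (2 : ℝ≥0∞) = ENNReal.ofReal 2 by simp, ← ENNReal.ofReal_mul (by norm_num)]
        congr 1; ring
      rw [this]; ring
    · rw [indicator_of_notMem (by exact ht)]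
      have : ∀ z, u (eMap n t z) = 0 := fun z => h0 _ (by rw [eMap_zero]; linarith)
      simp [this, indicator]
  rw [← key]
  apply lintegral_mono
  intro h
  exact mul_le_mul_right (trans_abs n u hu hfin h0 h) _

lemma u_fin {n : ℕ} (u : EuclideanSpace ℝ (Fin n) → ℝ) (hc : Continuous u)
    (hs : HasCompactSupport u) : ∫⁻ x, ENNReal.ofReal |u x| ≠ ∞ := by
  have := (hc.integrable_of_hasCompactSupport hs (μ := volume)).hasFiniteIntegral
  rw [hasFiniteIntegral_iff_norm] at this
  exact this.ne

theorem lower (n : ℕ) (s : ℝ) (hs : 0 < s) :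
    ENNReal.ofReal (Cconst (n + 1) s * (4 / s)) ≤
      hardyConst (n + 1) s 1 (halfSpace (n + 1) n.succ_pos) := by
  rw [hardyConst]
  apply le_sInf
  rintro c ⟨u, hu, hcs, hts, h1, rfl⟩
  rw [mul_comm, ENNReal.ofReal_mul (by positivity), mul_comm, ← cPrime_eq n s hs]
  refine lower_aux n s hs u hu.continuous.measurable (u_fin u hu.continuous hcs) ?_
    ((norm_cond n s u hu.continuous).mp h1)
  intro x hx
  by_contra hne
  have : x ∈ halfSpace (n + 1) n.succ_pos := hts (subset_tsupport _ hne)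
  exact absurd hx (not_le.mpr this)

lemma J_int (n : ℕ) (s : ℝ) (hs : 0 < s) (hs1 : s < 1) (L : ℝ) (hL : 0 ≤ L) :
    ∫⁻ h : EuclideanSpace ℝ (Fin (n + 1)),
      kerK n s h * ENNReal.ofReal (min 2 (L * ‖h‖)) ≠ ∞ := by
  have h1 : Integrable (fun h : EuclideanSpace ℝ (Fin (n + 1)) =>
      (fun y : ℝ => 1 / y ^ ((n : ℝ) + 1 + s) * min 2 (L * y)) ‖h‖) := by
    refine (integrable_fun_norm_addHaar volume
      (f := fun y : ℝ => 1 / y ^ ((n : ℝ) + 1 + s) * min 2 (L * y))).mpr ?_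
    simp only [finrank_euclideanSpace, Fintype.card_fin, Nat.add_sub_cancel, smul_eq_mul]
    have hm : Measurable (fun y : ℝ => y ^ n * (1 / y ^ ((n : ℝ) + 1 + s) * min 2 (L * y))) := by
      fun_prop
    have hf : ∀ y : ℝ, 0 < y → y ^ n * (1 / y ^ ((n : ℝ) + 1 + s) * min 2 (L * y)) =
        y ^ (-1 - s) * min 2 (L * y) := by
      intro y hy
      rw [← mul_assoc]
      congr 1
      rw [mul_one_div, ← Real.rpow_natCast, ← Real.rpow_sub hy]
      congr 1; ring
    rw [← Ioc_union_Ioi_eq_Ioi (zero_le_one (α := ℝ))]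
    apply IntegrableOn.union
    · have hg : IntegrableOn (fun y : ℝ => L * y ^ (-s)) (Ioc 0 1) := by
        apply Integrable.const_mul
        have := intervalIntegral.intervalIntegrable_rpow' (a := 0) (b := 1) (r := -s) (by linarith)
        rwa [intervalIntegrable_iff_integrableOn_Ioc_of_le zero_le_one] at this
      refine Integrable.mono' hg hm.aestronglyMeasurable ?_
      filter_upwards [ae_restrict_mem measurableSet_Ioc] with y hy
      have hy0 : 0 < y := hy.1
      have hmin : 0 ≤ min 2 (L * y) := by positivity
      rw [hf y hy.1, Real.norm_eq_abs, abs_of_nonneg (by positivity)]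
      calc y ^ (-1 - s) * min 2 (L * y) ≤ y ^ (-1 - s) * (L * y) := by
            gcongr; exact min_le_right _ _
        _ = L * y ^ (-s) := by
            rw [show -s = (-1 - s) + 1 by ring, Real.rpow_add hy0, Real.rpow_one]; ring
    · have hg : IntegrableOn (fun y : ℝ => 2 * y ^ (-1 - s)) (Ioi 1) :=
        (integrableOn_Ioi_rpow_of_lt (by linarith) one_pos).const_mul 2
      refine Integrable.mono' hg hm.aestronglyMeasurable ?_
      filter_upwards [ae_restrict_mem measurableSet_Ioi] with y hy
      have hy0 : 0 < y := one_pos.trans hy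
      have hmin : 0 ≤ min 2 (L * y) := by positivity
      rw [hf y hy0, Real.norm_eq_abs, abs_of_nonneg (by positivity), mul_comm]
      gcongr
      exact min_le_left _ _
  have h2 := h1.lintegral_lt_top
  convert h2.ne using 3 with h
  rw [kerK, ← ENNReal.ofReal_mul (by positivity)]

lemma J_tendsto (n : ℕ) (s : ℝ) (hs : 0 < s) (hs1 : s < 1) (L : ℝ) (hL : 0 ≤ L) :
    Tendsto (fun k : ℕ => ∫⁻ h : EuclideanSpace ℝ (Fin (n + 1)),
      kerK n s h * ENNReal.ofReal (min 2 (L * ((1 / ((k : ℝ) + 1)) * ‖h‖)))) atTop (nhds 0) := by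
  have := tendsto_lintegral_of_dominated_convergence (μ := volume)
    (F := fun (k : ℕ) (h : EuclideanSpace ℝ (Fin (n + 1))) =>
      kerK n s h * ENNReal.ofReal (min 2 (L * ((1 / ((k : ℝ) + 1)) * ‖h‖))))
    (f := fun _ => 0)
    (fun h => kerK n s h * ENNReal.ofReal (min 2 (L * ‖h‖)))
    (fun k => by fun_prop)
    (fun k => by
      filter_upwards with h
      gcongr
      have : 1 / ((k : ℝ) + 1) ≤ 1 := by
        rw [div_le_one (by positivity)]
        have : (0 : ℝ) ≤ k := by positivity
        linarith
      exact mul_le_of_le_one_left (norm_nonneg _) this)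
    (J_int n s hs hs1 L hL)
    (by
      filter_upwards with h
      have h1 : Tendsto (fun k : ℕ => ENNReal.ofReal (min 2 (L * ((1 / ((k : ℝ) + 1)) * ‖h‖))))
          atTop (nhds (ENNReal.ofReal (min 2 (L * (0 * ‖h‖))))) := by
        apply ENNReal.tendsto_ofReal
        exact tendsto_const_nhds.min ((tendsto_one_div_add_atTop_nhds_zero_nat.mul_const _).const_mul _)
      have h2 := ENNReal.Tendsto.const_mul (a := kerK n s h) h1 (Or.inr (by simp [kerK]))
      simpa using h2)
  simpa using this

lemma exists_eta (n : ℕ) : ∃ (η : EuclideanSpace ℝ (Fin n) → ℝ) (L : ℝ), 0 ≤ L ∧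
    ContDiff ℝ (⊤ : ℕ∞) η ∧ HasCompactSupport η ∧ (∀ z, 0 ≤ η z) ∧
    (∫⁻ z, ENNReal.ofReal (η z) = 1) ∧
    ∀ ζ, ∫⁻ z, ENNReal.ofReal |η z - η (z + ζ)| ≤ ENNReal.ofReal (min 2 (L * ‖ζ‖)) := by
  let f : ContDiffBump (0 : EuclideanSpace ℝ (Fin n)) := default
  let η := f.normed volume
  have hη : ContDiff ℝ (⊤ : ℕ∞) η := f.contDiff_normed
  have hc : HasCompactSupport η := f.hasCompactSupport_normed
  have hn : ∀ z, 0 ≤ η z := f.nonneg_normed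
  have hi : ∫⁻ z, ENNReal.ofReal (η z) = 1 := by
    rw [← ofReal_integral_eq_lintegral_ofReal f.integrable_normed (Eventually.of_forall hn),
      f.integral_normed]
    simp
  have hηm : Measurable η := hη.continuous.measurable
  obtain ⟨C, hC⟩ := ContDiff.lipschitzWith_of_hasCompactSupport hc hη (by simp)
  set K := tsupport η with hK
  have hKm : MeasurableSet K := (isClosed_tsupport η).measurableSet
  have hKf : volume K ≠ ∞ := hc.measure_lt_top.ne
  refine ⟨η, C * (2 * (volume K).toReal), by positivity, hη, hc, hn, hi, ?_⟩
  intro ζ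
  have b1 : ∫⁻ z, ENNReal.ofReal |η z - η (z + ζ)| ≤ ENNReal.ofReal 2 := by
    calc ∫⁻ z, ENNReal.ofReal |η z - η (z + ζ)| ≤
        ∫⁻ z, (ENNReal.ofReal (η z) + ENNReal.ofReal (η (z + ζ))) := by
          apply lintegral_mono
          intro z
          simp only
          rw [← ENNReal.ofReal_add (hn _) (hn _)]
          apply ENNReal.ofReal_le_ofReal
          rw [abs_le]; constructor <;> linarith [hn z, hn (z + ζ)]
      _ = ENNReal.ofReal 2 := by
          rw [lintegral_add_left (by fun_prop),
            lintegral_add_right_eq_self (fun z => ENNReal.ofReal (η z)), hi]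
          norm_num
  have b2 : ∫⁻ z, ENNReal.ofReal |η z - η (z + ζ)| ≤
      ENNReal.ofReal (C * (2 * (volume K).toReal) * ‖ζ‖) := by
    calc ∫⁻ z, ENNReal.ofReal |η z - η (z + ζ)| ≤
        ∫⁻ z, ENNReal.ofReal (C * ‖ζ‖) * (K.indicator 1 z + K.indicator 1 (z + ζ)) := by
          apply lintegral_mono
          intro z
          simp only
          by_cases h1 : z ∈ K ∨ z + ζ ∈ K
          · have h2 : (1 : ℝ≥0∞) ≤ K.indicator 1 z + K.indicator 1 (z + ζ) := by
              rcases h1 with h1 | h1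
              · simp [h1]
              · simp [h1]
            refine le_trans ?_ (le_mul_of_one_le_right zero_le h2)
            apply ENNReal.ofReal_le_ofReal
            have := hC.dist_le_mul z (z + ζ)
            simpa [Real.dist_eq] using this
          · push Not at h1
            have e1 : η z = 0 := image_eq_zero_of_notMem_tsupport h1.1
            have e2 : η (z + ζ) = 0 := image_eq_zero_of_notMem_tsupport h1.2
            simp [e1, e2]
      _ = ENNReal.ofReal (C * (2 * (volume K).toReal) * ‖ζ‖) := by
          have hm : Measurable (K.indicator (1 : EuclideanSpace ℝ (Fin n) → ℝ≥0∞)) :=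
            measurable_one.indicator hKm
          rw [lintegral_const_mul _ (by fun_prop), lintegral_add_left hm,
            lintegral_add_right_eq_self (K.indicator 1), lintegral_indicator_one hKm]
          nth_rewrite 1 2 [← ENNReal.ofReal_toReal hKf]
          rw [← ENNReal.ofReal_add (by positivity) (by positivity),
            ← ENNReal.ofReal_mul (by positivity)]
          congr 1; ring
  rw [ENNReal.ofReal_min]
  exact le_min b1 b2

lemma gag_one (s : ℝ) (u : EuclideanSpace ℝ (Fin 1) → ℝ) (hu : Measurable u) :
    gagliardo 1 s 1 univ u = ∫⁻ τ, ENNReal.ofReal (|τ| ^ (-1 - s)) *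
      ∫⁻ t, ENNReal.ofReal |u (eMap 0 t 0) - u (eMap 0 (t + τ) 0)| := by
  have hm : Measurable (fun h => ∫⁻ x, ENNReal.ofReal |u x - u (x + h)|) := by
    apply Measurable.lintegral_prod_right'
      (f := fun q : EuclideanSpace ℝ (Fin 1) × EuclideanSpace ℝ (Fin 1) =>
        ENNReal.ofReal |u q.2 - u (q.2 + q.1)|)
    fun_prop
  rw [gag_eq' 0 s u hu, lintegral_eMap 0 _ (by fun_prop)]
  have hae : ∀ᵐ τ : ℝ, τ ≠ 0 := by
    simp [ae_iff]
  apply lintegral_congr_ae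
  filter_upwards [hae] with τ hτ
  have h1 := lintegral_kerK 0 s τ hτ
  rw [lintegral_zero_dim, cPrime, lintegral_zero_dim] at h1
  rw [lintegral_zero_dim, h1, lintegral_eMap 0 _ (by fun_prop)]
  simp only [lintegral_zero_dim, eMap_add]
  simp

noncomputable def tailMap (n : ℕ) (x : EuclideanSpace ℝ (Fin (n + 1))) : EuclideanSpace ℝ (Fin n) :=
  WithLp.toLp 2 (fun i => x i.succ)

lemma tailMap_eMap (n : ℕ) (t : ℝ) (z : EuclideanSpace ℝ (Fin n)) : tailMap n (eMap n t z) = z := by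
  ext i; simp [tailMap, eMap]

lemma eMap_tailMap (n : ℕ) (x : EuclideanSpace ℝ (Fin (n + 1))) :
    eMap n (x ⟨0, n.succ_pos⟩) (tailMap n x) = x := by
  ext i
  refine Fin.cases ?_ (fun j => ?_) i <;> simp [eMap, tailMap]

lemma tailMap_contDiff (n : ℕ) {m : WithTop ℕ∞} : ContDiff ℝ m (tailMap n) := by
  rw [contDiff_euclidean]
  intro i
  simp only [tailMap]
  fun_prop

lemma G_scale {n : ℕ} (η : EuclideanSpace ℝ (Fin n) → ℝ) (hη : Measurable η) (L : ℝ)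
    (hG : ∀ ζ, ∫⁻ z, ENNReal.ofReal |η z - η (z + ζ)| ≤ ENNReal.ofReal (min 2 (L * ‖ζ‖)))
    (a : ℝ) (ha : 0 < a) (ζ : EuclideanSpace ℝ (Fin n)) :
    ∫⁻ z, ENNReal.ofReal |a ^ n * η (a • z) - a ^ n * η (a • (z + ζ))| ≤
      ENNReal.ofReal (min 2 (L * (a * ‖ζ‖))) := by
  have := hG (a • ζ)
  rw [lintegral_smul' a ha _ (by fun_prop), ← lintegral_const_mul _ (by fun_prop), norm_smul,
    Real.norm_eq_abs, abs_of_pos ha] at this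
  refine le_trans (le_of_eq ?_) this
  congr 1; ext z
  rw [← ENNReal.ofReal_mul (by positivity), ← mul_sub, abs_mul, abs_of_pos (pow_pos ha n), smul_add]

lemma upper_gag (n : ℕ) (s : ℝ) (hs : 0 < s) (φ : EuclideanSpace ℝ (Fin 1) → ℝ) (hφ : Measurable φ)
    (ψ : EuclideanSpace ℝ (Fin n) → ℝ) (hψ : Measurable ψ) (hψ0 : ∀ z, 0 ≤ ψ z)
    (hψ1 : ∫⁻ z, ENNReal.ofReal (ψ z) = 1) (g : ℝ → ℝ≥0∞) (hg : Measurable g) (hgm : Monotone g)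
    (hG : ∀ ζ, ∫⁻ z, ENNReal.ofReal |ψ z - ψ (z + ζ)| ≤ g ‖ζ‖)
    (u : EuclideanSpace ℝ (Fin (n + 1)) → ℝ) (hu : Measurable u)
    (huφ : ∀ t z, u (eMap n t z) = φ (eMap 0 t 0) * ψ z) :
    gagliardo (n + 1) s 1 univ u ≤ cPrime n s * gagliardo 1 s 1 univ φ +
      (∫⁻ t, ENNReal.ofReal |φ (eMap 0 t 0)|) * ∫⁻ h, kerK n s h * g ‖h‖ := by
  set D : ℝ → ℝ≥0∞ := fun τ => ∫⁻ t, ENNReal.ofReal |φ (eMap 0 t 0) - φ (eMap 0 (t + τ) 0)| with hD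
  have hDm : Measurable D := by
    apply Measurable.lintegral_prod_right'
      (f := fun q : ℝ × ℝ => ENNReal.ofReal |φ (eMap 0 q.2 0) - φ (eMap 0 (q.2 + q.1) 0)|)
    fun_prop
  set M := ∫⁻ t, ENNReal.ofReal |φ (eMap 0 t 0)| with hM
  have hpt : ∀ τ ζ, ∫⁻ x, ENNReal.ofReal |u x - u (x + eMap n τ ζ)| ≤
      D τ + M * g ‖eMap n τ ζ‖ := by
    intro τ ζ
    rw [lintegral_eMap n _ (by fun_prop)]
    simp only [eMap_add, huφ]
    calc ∫⁻ t, ∫⁻ z, ENNReal.ofReal |φ (eMap 0 t 0) * ψ z - φ (eMap 0 (t + τ) 0) * ψ (z + ζ)|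
        ≤ ∫⁻ t, ∫⁻ z, (ENNReal.ofReal |φ (eMap 0 t 0) - φ (eMap 0 (t + τ) 0)| *
            ENNReal.ofReal (ψ (z + ζ)) +
            ENNReal.ofReal |φ (eMap 0 t 0)| * ENNReal.ofReal |ψ z - ψ (z + ζ)|) := by
          apply lintegral_mono; intro t
          apply lintegral_mono; intro z
          simp only
          rw [← ENNReal.ofReal_mul (abs_nonneg _), ← ENNReal.ofReal_mul (abs_nonneg _),
            ← ENNReal.ofReal_add (mul_nonneg (abs_nonneg _) (hψ0 _)) (by positivity)]
          apply ENNReal.ofReal_le_ofReal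
          calc _ = |(φ (eMap 0 t 0) - φ (eMap 0 (t + τ) 0)) * ψ (z + ζ) +
                φ (eMap 0 t 0) * (ψ z - ψ (z + ζ))| := by congr 1; ring
            _ ≤ _ := abs_add_le _ _
            _ = _ := by rw [abs_mul, abs_mul, abs_of_nonneg (hψ0 (z + ζ))]
      _ = ∫⁻ t, (ENNReal.ofReal |φ (eMap 0 t 0) - φ (eMap 0 (t + τ) 0)| +
            ENNReal.ofReal |φ (eMap 0 t 0)| * ∫⁻ z, ENNReal.ofReal |ψ z - ψ (z + ζ)|) := by
          congr 1; ext t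
          rw [lintegral_add_left (by fun_prop), lintegral_const_mul _ (by fun_prop),
            lintegral_const_mul _ (by fun_prop),
            lintegral_add_right_eq_self (fun z => ENNReal.ofReal (ψ z)), hψ1, mul_one]
      _ = D τ + M * ∫⁻ z, ENNReal.ofReal |ψ z - ψ (z + ζ)| := by
          rw [lintegral_add_left (by fun_prop), lintegral_mul_const _ (by fun_prop)]
      _ ≤ D τ + M * g ‖eMap n τ ζ‖ := by
          gcongr
          refine (hG ζ).trans (hgm ?_)
          rw [← sq_le_sq₀ (norm_nonneg _) (norm_nonneg _), eMap_norm_sq]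
          nlinarith [sq_nonneg τ]
  have hm : Measurable (fun h => ∫⁻ x, ENNReal.ofReal |u x - u (x + h)|) := by
    apply Measurable.lintegral_prod_right'
      (f := fun q : EuclideanSpace ℝ (Fin (n + 1)) × EuclideanSpace ℝ (Fin (n + 1)) =>
        ENNReal.ofReal |u q.2 - u (q.2 + q.1)|)
    fun_prop
  rw [gag_eq' n s u hu, gag_one s φ hφ]
  calc ∫⁻ h, kerK n s h * ∫⁻ x, ENNReal.ofReal |u x - u (x + h)|
      ≤ ∫⁻ h, (kerK n s h * D (h ⟨0, n.succ_pos⟩) + M * (kerK n s h * g ‖h‖)) := by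
        apply lintegral_mono
        intro h
        have := hpt (h ⟨0, n.succ_pos⟩) (tailMap n h)
        rw [eMap_tailMap] at this
        calc _ ≤ kerK n s h * (D (h ⟨0, n.succ_pos⟩) + M * g ‖h‖) := mul_le_mul_right this _
          _ = _ := by ring
    _ = (∫⁻ h, kerK n s h * D (h ⟨0, n.succ_pos⟩)) + M * ∫⁻ h, kerK n s h * g ‖h‖ := by
        rw [lintegral_add_left (by fun_prop), lintegral_const_mul _ (by fun_prop)]
    _ = _ := by
        congr 1
        rw [lintegral_eMap n _ (by fun_prop), ← lintegral_const_mul _ (by fun_prop)]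
        have hae : ∀ᵐ τ : ℝ, τ ≠ 0 := by
          simp [ae_iff]
        apply lintegral_congr_ae
        filter_upwards [hae] with τ hτ
        simp only [eMap_zero]
        rw [lintegral_mul_const _ (by fun_prop), lintegral_kerK n s τ hτ, mul_assoc]

theorem upper (n : ℕ) (s : ℝ) (hs : 0 < s) (hs1 : s < 1) :
    hardyConst (n + 1) s 1 (halfSpace (n + 1) n.succ_pos) ≤
      ENNReal.ofReal (Cconst (n + 1) s) * hardyConst 1 s 1 (halfSpace 1 Nat.one_pos) := by
  rw [← cPrime_eq n s hs, mul_comm]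
  have hC0 := cPrime_ne_zero n s
  have hCt : cPrime n s ≠ ∞ := by rw [cPrime_eq n s hs]; simp
  rw [← ENNReal.div_le_iff_le_mul (Or.inl hC0) (Or.inl hCt)]
  nth_rewrite 2 [hardyConst]
  apply le_sInf
  rintro c ⟨φ, hφ, hφc, hφs, hφ1, rfl⟩
  rw [ENNReal.div_le_iff_le_mul (Or.inl hC0) (Or.inl hCt), mul_comm]
  have hφm : Measurable φ := hφ.continuous.measurable
  obtain ⟨η, L, hL, hη, hηc, hη0, hη1, hηG⟩ := exists_eta n
  have hηm : Measurable η := hη.continuous.measurable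
  have hφ1' := (norm_cond 0 s φ hφ.continuous).mp hφ1
  simp only [lintegral_zero_dim] at hφ1'
  set M := ∫⁻ t, ENNReal.ofReal |φ (eMap 0 t 0)| with hM
  have hMt : M ≠ ∞ := by
    have := u_fin φ hφ.continuous hφc
    rw [lintegral_eMap 0 _ (by fun_prop)] at this
    simpa only [lintegral_zero_dim] using this
  have main : ∀ k : ℕ, hardyConst (n + 1) s 1 (halfSpace (n + 1) n.succ_pos) ≤
      cPrime n s * gagliardo 1 s 1 univ φ + M * ∫⁻ h : EuclideanSpace ℝ (Fin (n + 1)),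
      kerK n s h * ENNReal.ofReal (min 2 (L * ((1 / ((k : ℝ) + 1)) * ‖h‖))) := by
    intro k
    set a : ℝ := 1 / ((k : ℝ) + 1) with ha'
    have ha : 0 < a := by positivity
    set ψ : EuclideanSpace ℝ (Fin n) → ℝ := fun z => a ^ n * η (a • z) with hψ
    have hψd : ContDiff ℝ (⊤ : ℕ∞) ψ := contDiff_const.mul (hη.comp (contDiff_const_smul a))
    have hψm : Measurable ψ := hψd.continuous.measurable
    have hψ0 : ∀ z, 0 ≤ ψ z := fun z => mul_nonneg (by positivity) (hη0 _)
    have hψ1 : ∫⁻ z, ENNReal.ofReal (ψ z) = 1 := by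
      rw [← hη1, lintegral_smul' a ha (fun z => ENNReal.ofReal (η z)) (by fun_prop),
        ← lintegral_const_mul _ (by fun_prop)]
      congr 1; ext z
      rw [← ENNReal.ofReal_mul (by positivity)]
    have hψc : HasCompactSupport ψ := by
      have : HasCompactSupport (fun z => η (a • z)) :=
        hηc.comp_homeomorph (Homeomorph.smulOfNeZero a ha.ne')
      exact this.mul_left
    set u : EuclideanSpace ℝ (Fin (n + 1)) → ℝ := fun x =>
      φ (eMap 0 (x ⟨0, n.succ_pos⟩) 0) * ψ (tailMap n x) with hu
    have hud : ContDiff ℝ (⊤ : ℕ∞) u := by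
      apply ContDiff.mul
      · apply hφ.comp
        exact (eMap_contDiff 0).comp ((by fun_prop :
          ContDiff ℝ (⊤ : ℕ∞) (fun x : EuclideanSpace ℝ (Fin (n + 1)) =>
            (x ⟨0, n.succ_pos⟩, (0 : EuclideanSpace ℝ (Fin 0))))))
      · exact hψd.comp (tailMap_contDiff n)
    set K := (fun p : ℝ × EuclideanSpace ℝ (Fin n) => eMap n p.1 p.2) ''
      (((fun x : EuclideanSpace ℝ (Fin 1) => x ⟨0, Nat.one_pos⟩) '' tsupport φ) ×ˢ tsupport ψ) with hK
    have hKc : IsCompact K := by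
      apply IsCompact.image _ (eMap_continuous n)
      apply IsCompact.prod _ hψc
      exact IsCompact.image hφc (by fun_prop)
    have hKu : Function.support u ⊆ K := by
      intro x hx
      rw [Function.mem_support, hu] at hx
      have h1 := left_ne_zero_of_mul hx
      have h2 := right_ne_zero_of_mul hx
      refine ⟨(x ⟨0, n.succ_pos⟩, tailMap n x), ⟨⟨_, subset_tsupport _ h1, rfl⟩,
        subset_tsupport _ h2⟩, eMap_tailMap n x⟩
    have hts : tsupport u ⊆ K := closure_minimal hKu hKc.isClosed
    have hKh : K ⊆ halfSpace (n + 1) n.succ_pos := by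
      rintro _ ⟨⟨t, z⟩, ⟨⟨y, hy, hyt⟩, _⟩, rfl⟩
      have := hφs hy
      simp only at hyt
      subst hyt
      exact this
    have hue : ∀ t z, u (eMap n t z) = φ (eMap 0 t 0) * ψ z := by
      intro t z
      simp only [hu, eMap_zero, tailMap_eMap]
    have hmem : hardyConst (n + 1) s 1 (halfSpace (n + 1) n.succ_pos) ≤
        gagliardo (n + 1) s 1 univ u := by
      apply sInf_le
      refine ⟨u, hud, hKc.of_isClosed_subset (isClosed_tsupport u) hts, hts.trans hKh, ?_, rfl⟩
      rw [norm_cond n s u hud.continuous, ← hφ1']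
      congr 1; ext t
      have : ∀ z, ENNReal.ofReal |u (eMap n t z)| * ENNReal.ofReal (t ^ (-s)) =
          (ENNReal.ofReal |φ (eMap 0 t 0)| * ENNReal.ofReal (t ^ (-s))) * ENNReal.ofReal (ψ z) := by
        intro z
        rw [hue, abs_mul, abs_of_nonneg (hψ0 z), ENNReal.ofReal_mul (abs_nonneg _)]
        ring
      simp_rw [this]
      rw [lintegral_const_mul _ (by fun_prop), hψ1, mul_one]
    refine hmem.trans ?_
    exact upper_gag n s hs φ hφm ψ hψm hψ0 hψ1
      (fun r => ENNReal.ofReal (min 2 (L * (a * r)))) (by fun_prop)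
      (fun r r' h => by
        simp only
        gcongr)
      (fun ζ => G_scale η hηm L hηG a ha ζ) u hud.continuous.measurable hue
  have ht : Tendsto (fun k : ℕ => cPrime n s * gagliardo 1 s 1 univ φ +
      M * ∫⁻ h : EuclideanSpace ℝ (Fin (n + 1)),
      kerK n s h * ENNReal.ofReal (min 2 (L * ((1 / ((k : ℝ) + 1)) * ‖h‖)))) atTop
      (nhds (cPrime n s * gagliardo 1 s 1 univ φ + M * 0)) :=
    tendsto_const_nhds.add (ENNReal.Tendsto.const_mul (J_tendsto n s hs hs1 L hL) (Or.inr hMt))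
  rw [mul_zero, add_zero] at ht
  exact ge_of_tendsto' ht main

/-- `C_{N,s}·(4/s) ≤ 𝔥_{s,1}(ℍ^N₊) ≤ C_{N,s}·𝔥_{s,1}(ℍ^1₊)`. -/
theorem hardy_halfSpace_two_sided (N : ℕ) (hN : 0 < N) (s : ℝ)
    (hs : s ∈ Set.Ioo (0 : ℝ) 1) :
    ENNReal.ofReal (Cconst N s * (4 / s)) ≤ hardyConst N s 1 (halfSpace N hN) ∧
      hardyConst N s 1 (halfSpace N hN) ≤
        ENNReal.ofReal (Cconst N s) * hardyConst 1 s 1 (halfSpace 1 Nat.one_pos) := by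
  obtain ⟨n, rfl⟩ : ∃ n, N = n + 1 := ⟨N - 1, by omega⟩
  exact ⟨lower n s hs.1, upper n s hs.1 hs.2⟩
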